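/- Assume all n jobs have the same processing time p ≥ 0, the setup time is s ≥ 0, m ≥ 1 and n ≥ 1. Then the minimum makespan over all feasible m-machine schedules equals ⌈(n − ν(G))/m⌉·p + (⌈(n − ν(G))/m⌉ − 1)·s. -/

import Mathlib

open Finset

/-- `M` is a matching of `G`: a finite set of edges of `G` that are pairwise
vertex-disjoint. -/
def IsMatchingFinset {V : Type*} (G : SimpleGraph V) (M : Finset (Sym2 V)) : Prop :=
  (∀ e ∈ M, e ∈ G.edgeSet) ∧
  (M : Set (Sym2 V)).Pairwise fun e f => ∀ v : V, v ∈ e → v ∉ f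

/-- The matching number `ν(G)`: the maximum cardinality of a matching of `G`. -/
noncomputable def matchingNumber {V : Type*} (G : SimpleGraph V) : ℕ :=
  sSup {k : ℕ | ∃ M : Finset (Sym2 V), IsMatchingFinset G M ∧ M.card = k}

/-- A batch partition of the vertex set: each vertex lies in exactly one part,
and each part is either a singleton or a pair of adjacent vertices. -/
def IsBatchPartition {V : Type*} [DecidableEq V] (G : SimpleGraph V)
    (P : Finset (Finset V)) : Prop :=
  (∀ v : V, ∃! t : Finset V, t ∈ P ∧ v ∈ t) ∧
  (∀ t ∈ P, (∃ v : V, t = {v}) ∨ (∃ u v : V, G.Adj u v ∧ t = {u, v}))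

theorem bddAbove_card_matching {V : Type*} [Fintype V] (G : SimpleGraph V) :
    BddAbove {k : ℕ | ∃ M : Finset (Sym2 V), IsMatchingFinset G M ∧ M.card = k} := by
  classical
  refine ⟨Fintype.card (Sym2 V), ?_⟩
  rintro k ⟨M, -, rfl⟩
  exact Finset.card_le_univ M

theorem card_le_matchingNumber {V : Type*} [Fintype V] {G : SimpleGraph V}
    {M : Finset (Sym2 V)} (hM : IsMatchingFinset G M) : M.card ≤ matchingNumber G :=
  le_csSup (bddAbove_card_matching G) ⟨M, hM, rfl⟩

theorem exists_matching_card_eq {V : Type*} [Fintype V] (G : SimpleGraph V) :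
    ∃ M : Finset (Sym2 V), IsMatchingFinset G M ∧ M.card = matchingNumber G :=
  Nat.sSup_mem (s := {k : ℕ | ∃ M : Finset (Sym2 V), IsMatchingFinset G M ∧ M.card = k})
    ⟨0, ∅, by simp [IsMatchingFinset], rfl⟩ (bddAbove_card_matching G)

theorem Sym2.toFinset_injective {V : Type*} [DecidableEq V] :
    Function.Injective (Sym2.toFinset : Sym2 V → Finset V) := by
  intro e f h
  refine Sym2.ext fun x => ?_
  rw [← Sym2.mem_toFinset, ← Sym2.mem_toFinset, h]

theorem IsBatchPartition.card_add_card_pairs {V : Type*} [Fintype V] [DecidableEq V]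
    {G : SimpleGraph V} {P : Finset (Finset V)} (hP : IsBatchPartition G P) :
    P.card + (P.filter fun t => t.card = 2).card = Fintype.card V := by
  have hsum : ∑ t ∈ P, t.card = Fintype.card V := by
    have h := Finset.sum_card_bipartiteAbove_eq_sum_card_bipartiteBelow
      (s := P) (t := (Finset.univ : Finset V)) (fun t v => v ∈ t)
    have h1 : ∀ v : V, (P.filter fun t => v ∈ t).card = 1 := by
      intro v
      obtain ⟨t, ht, hu⟩ := hP.1 v
      refine Finset.card_eq_one.mpr ⟨t, ?_⟩
      ext u
      simp only [Finset.mem_filter, Finset.mem_singleton]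
      exact ⟨fun h => hu u h, fun h => h ▸ ht⟩
    simpa [Finset.bipartiteAbove, Finset.bipartiteBelow, h1] using h
  rw [← hsum, Finset.card_filter, Finset.card_eq_sum_ones, ← Finset.sum_add_distrib]
  refine Finset.sum_congr rfl fun t ht => ?_
  rcases hP.2 t ht with ⟨v, rfl⟩ | ⟨u, v, huv, rfl⟩
  · simp
  · simp [Finset.card_pair huv.ne]

theorem IsBatchPartition.card_pairs_le {V : Type*} [Fintype V] [DecidableEq V]
    {G : SimpleGraph V} {P : Finset (Finset V)} (hP : IsBatchPartition G P) :
    (P.filter fun t => t.card = 2).card ≤ matchingNumber G := by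
  classical
  let M : Finset (Sym2 V) :=
    Finset.univ.filter fun e => e ∈ G.edgeSet ∧ e.toFinset ∈ P
  have hM : IsMatchingFinset G M := by
    refine ⟨fun e he => (Finset.mem_filter.mp he).2.1, ?_⟩
    intro e he f hf hne v hve hvf
    refine hne (Sym2.toFinset_injective ((hP.1 v).unique ?_ ?_))
    · exact ⟨(Finset.mem_filter.mp he).2.2, Sym2.mem_toFinset.mpr hve⟩
    · exact ⟨(Finset.mem_filter.mp hf).2.2, Sym2.mem_toFinset.mpr hvf⟩
  have hsub : (P.filter fun t => t.card = 2) ⊆ M.image Sym2.toFinset := by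
    intro t ht
    obtain ⟨htP, htc⟩ := Finset.mem_filter.mp ht
    rcases hP.2 t htP with ⟨v, rfl⟩ | ⟨u, v, huv, rfl⟩
    · simp at htc
    · exact Finset.mem_image.mpr ⟨s(u, v),
      by simpa [M, huv, Sym2.toFinset_mk_eq] using htP, Sym2.toFinset_mk_eq⟩
  exact ((Finset.card_le_card hsub).trans Finset.card_image_le).trans
    (card_le_matchingNumber hM)

theorem IsMatchingFinset.exists_isBatchPartition {V : Type*} [Fintype V] [DecidableEq V]
    {G : SimpleGraph V} {M : Finset (Sym2 V)} (hM : IsMatchingFinset G M) :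
    ∃ P : Finset (Finset V), IsBatchPartition G P ∧ P.card + M.card = Fintype.card V := by
  classical
  let P : Finset (Finset V) := M.image Sym2.toFinset ∪
    (Finset.univ.filter fun v => ∀ e ∈ M, v ∉ e).image fun v => {v}
  have hmem : ∀ t, t ∈ P ↔
      (∃ e ∈ M, e.toFinset = t) ∨ ∃ v, (∀ e ∈ M, v ∉ e) ∧ {v} = t := by
    intro t
    simp [P]
  have hP : IsBatchPartition G P := by
    constructor
    · intro v
      by_cases hv : ∃ e ∈ M, v ∈ e
      · obtain ⟨e, he, hve⟩ := hv
        refine ⟨e.toFinset,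
          ⟨(hmem _).mpr (Or.inl ⟨e, he, rfl⟩), Sym2.mem_toFinset.mpr hve⟩, ?_⟩
        rintro t ⟨ht, hvt⟩
        rcases (hmem t).mp ht with ⟨f, hf, rfl⟩ | ⟨w, hw, rfl⟩
        · by_contra hne
          exact hM.2 hf he (fun h => hne (h ▸ rfl)) v (Sym2.mem_toFinset.mp hvt) hve
        · rw [Finset.mem_singleton] at hvt
          exact absurd (hvt ▸ hve) (hw e he)
      · push Not at hv
        refine ⟨{v}, ⟨(hmem _).mpr (Or.inr ⟨v, hv, rfl⟩), Finset.mem_singleton_self v⟩, ?_⟩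
        rintro t ⟨ht, hvt⟩
        rcases (hmem t).mp ht with ⟨f, hf, rfl⟩ | ⟨w, hw, rfl⟩
        · exact absurd (Sym2.mem_toFinset.mp hvt) (hv f hf)
        · rw [Finset.mem_singleton.mp hvt]
    · intro t ht
      rcases (hmem t).mp ht with ⟨e, he, rfl⟩ | ⟨w, -, rfl⟩
      · have hG := hM.1 e he
        induction e with
        | _ u v => exact Or.inr ⟨u, v, hG, Sym2.toFinset_mk_eq⟩
      · exact Or.inl ⟨w, rfl⟩
  have hpairs : (P.filter fun t => t.card = 2) = M.image Sym2.toFinset := by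
    ext t
    rw [Finset.mem_filter, hmem, Finset.mem_image]
    constructor
    · rintro ⟨h | ⟨v, -, rfl⟩, hc⟩
      · exact h
      · simp at hc
    · rintro ⟨e, he, rfl⟩
      exact ⟨Or.inl ⟨e, he, rfl⟩,
        Sym2.card_toFinset_of_not_isDiag e (G.not_isDiag_of_mem_edgeSet (hM.1 e he))⟩
  refine ⟨P, hP, ?_⟩
  rw [← hP.card_add_card_pairs, hpairs,
    Finset.card_image_of_injective _ Sym2.toFinset_injective]

theorem exists_balanced_assignment {α : Type*} (P : Finset α) {m : ℕ} (hm : 1 ≤ m) :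
    ∃ f : α → Fin m, ∀ k, (P.filter fun t => f t = k).card ≤ ⌈(P.card : ℚ) / m⌉₊ := by
  classical
  have hm0 : (0 : ℚ) < m := by exact_mod_cast hm
  let i : α → ℕ := fun t => if h : t ∈ P then (P.equivFin ⟨t, h⟩ : ℕ) else 0
  have hlt : ∀ t ∈ P, i t < P.card := by
    intro t ht
    simp [i, ht]
  have hinj : ∀ t ∈ P, ∀ u ∈ P, i t = i u → t = u := by
    intro t ht u hu h
    simp only [i, ht, hu, dif_pos] at h
    simpa using P.equivFin.injective (Fin.ext h)
  refine ⟨fun t => ⟨i t % m, Nat.mod_lt _ hm⟩, fun k => ?_⟩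
  rw [← Finset.card_range ⌈(P.card : ℚ) / m⌉₊]
  refine Finset.card_le_card_of_injOn (fun t => i t / m) ?_ ?_
  · intro t ht
    have htP := (Finset.mem_filter.mp ht).1
    rw [Finset.coe_range, Set.mem_Iio, Nat.lt_ceil, lt_div_iff₀ hm0]
    exact_mod_cast (Nat.div_mul_le_self (i t) m).trans_lt (hlt t htP)
  · intro t ht u hu h
    obtain ⟨htP, htk⟩ := Finset.mem_filter.mp ht
    obtain ⟨huP, huk⟩ := Finset.mem_filter.mp hu
    refine hinj t htP u huP ?_
    have hmod : i t % m = i u % m := congrArg Fin.val (htk.trans huk.symm)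
    rw [← Nat.div_add_mod (i t) m, ← Nat.div_add_mod (i u) m, hmod]
    simp only at h
    rw [h]

/-- Pigeonhole principle: some machine receives at least the rounded-up average load. -/
theorem exists_ceil_le_card_fiber {α : Type*} (P : Finset α) {m N : ℕ} (hm : 1 ≤ m)
    (hN : N ≤ P.card) (f : α → Fin m) :
    ∃ k, ⌈(N : ℚ) / m⌉₊ ≤ (P.filter fun t => f t = k).card := by
  have hm0 : (0 : ℚ) < m := by exact_mod_cast hm
  have : Nonempty (Fin m) := ⟨⟨0, hm⟩⟩
  obtain ⟨k, -, hk⟩ := Finset.exists_le_card_fiber_of_nsmul_le_card_of_maps_to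
    (s := P) (t := (Finset.univ : Finset (Fin m))) (f := f) (b := (P.card : ℚ) / m)
    (fun _ _ => Finset.mem_univ _) Finset.univ_nonempty
    (by simp [mul_div_cancel₀ _ hm0.ne'])
  refine ⟨k, Nat.ceil_le.mpr (le_trans ?_ hk)⟩
  gcongr

/-- The completion time of a machine is monotone in the number of its batches. -/
theorem monotone_machine_completion {p s : ℝ} (hp : 0 ≤ p) (hs : 0 ≤ s) :
    Monotone fun t : ℕ => if t = 0 then (0 : ℝ) else (t : ℝ) * p + ((t : ℝ) - 1) * s := by
  refine monotone_nat_of_le_succ fun t => ?_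
  rcases Nat.eq_zero_or_pos t with rfl | ht
  · simpa using hp
  · simp only [ht.ne', Nat.succ_ne_zero, if_false]
    push_cast
    linarith

theorem stmt_6 {V : Type*} [Fintype V] [DecidableEq V] (G : SimpleGraph V)
    (p s : ℝ) (hp : 0 ≤ p) (hs : 0 ≤ s) (m : ℕ) (hm : 1 ≤ m)
    (hn : 1 ≤ Fintype.card V) :
    IsLeast
      {z : ℝ | ∃ (P : Finset (Finset V)) (f : Finset V → Fin m),
        IsBatchPartition G P ∧
        z = Finset.univ.sup' (Finset.univ_nonempty_iff.mpr ⟨⟨0, hm⟩⟩)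
          (fun k : Fin m =>
            if (P.filter fun t => f t = k).card = 0 then 0
            else ((P.filter fun t => f t = k).card : ℝ) * p
              + (((P.filter fun t => f t = k).card : ℝ) - 1) * s)}
      ((⌈((Fintype.card V - matchingNumber G : ℕ) : ℚ) / (m : ℚ)⌉ : ℝ) * p
        + ((⌈((Fintype.card V - matchingNumber G : ℕ) : ℚ) / (m : ℚ)⌉ : ℝ) - 1) * s) := by
  set N := Fintype.card V - matchingNumber G
  obtain ⟨M, hM, hMcard⟩ := exists_matching_card_eq G
  obtain ⟨P, hP, hPcard⟩ := hM.exists_isBatchPartition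
  have hPN : P.card = N := by omega
  have hNpos : 0 < N := by
    obtain ⟨v⟩ := Fintype.card_pos_iff.mp hn
    obtain ⟨t, ⟨ht, -⟩, -⟩ := hP.1 v
    exact hPN ▸ Finset.card_pos.mpr ⟨t, ht⟩
  have hm0 : (0 : ℚ) < m := by exact_mod_cast hm
  have hc : ⌈(N : ℚ) / m⌉₊ ≠ 0 := (Nat.ceil_pos.mpr (by positivity)).ne'
  have hceil : ((⌈(N : ℚ) / (m : ℚ)⌉ : ℤ) : ℝ) = (⌈(N : ℚ) / m⌉₊ : ℝ) := by
    rw [← Int.natCast_ceil_eq_ceil (by positivity), Int.cast_natCast]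
  have hmono := monotone_machine_completion hp hs
  have hlower : ∀ (Q : Finset (Finset V)) (f : Finset V → Fin m), N ≤ Q.card →
      ((⌈(N : ℚ) / m⌉₊ : ℝ) * p + ((⌈(N : ℚ) / m⌉₊ : ℝ) - 1) * s) ≤
        Finset.univ.sup' (Finset.univ_nonempty_iff.mpr ⟨⟨0, hm⟩⟩)
          (fun k : Fin m =>
            if (Q.filter fun t => f t = k).card = 0 then 0
            else ((Q.filter fun t => f t = k).card : ℝ) * p
              + (((Q.filter fun t => f t = k).card : ℝ) - 1) * s) := by
    intro Q f hQ
    obtain ⟨k, hk⟩ := exists_ceil_le_card_fiber Q hm hQ f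
    refine le_trans ?_ (Finset.le_sup' _ (Finset.mem_univ k))
    simpa only [if_neg hc] using hmono hk
  rw [hceil]
  constructor
  · obtain ⟨f, hf⟩ := exists_balanced_assignment P hm
    refine ⟨P, f, hP, le_antisymm (hlower P f hPN.ge) (Finset.sup'_le _ _ fun k _ => ?_)⟩
    have hk := hf k
    rw [hPN] at hk
    simpa only [if_neg hc] using hmono hk
  · rintro z ⟨Q, f, hQ, rfl⟩
    refine hlower Q f ?_
    have h1 := hQ.card_add_card_pairs
    have h2 := hQ.card_pairs_le
    omega
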